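/- For every σ > 0 and every α with 0 < α < 1/2, the low-power asymptotics of capacity is: lim_{A → 0⁺} C(A, αA) / (A²/σ²) = α(1 − α)/2. -/

import Mathlib

open MeasureTheory ProbabilityTheory Real Filter Set
open scoped Classical Topology

/-- Kullback--Leibler divergence (in nats), valued in the extended reals:
`D(P ∥ R) = ∫ log (dP/dR) dP` if `P ≪ R` and the log-likelihood ratio is
`P`-integrable, and `+∞` otherwise. -/
noncomputable def klDiv {α : Type*} [MeasurableSpace α] (P R : Measure α) : EReal :=
  if P ≪ R ∧ Integrable (llr P R) P then ((∫ x, llr P R x ∂P : ℝ) : EReal) else ⊤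

/-- Joint law of `(X, Y)` where `X ~ Q` and `Y = X + Z` with `Z ~ N(0, σ²)`
independent of `X`. -/
noncomputable def jointLaw (σ : ℝ) (Q : Measure ℝ) : Measure (ℝ × ℝ) :=
  (Q.prod (gaussianReal 0 ⟨σ ^ 2, sq_nonneg σ⟩)).map (fun p => (p.1, p.1 + p.2))

/-- Mutual information `I(X;Y)` in nats: the KL divergence of the joint law of
`(X, Y)` from the product of its marginal laws. -/
noncomputable def mutualInfo (σ : ℝ) (Q : Measure ℝ) : EReal :=
  klDiv (jointLaw σ Q) (((jointLaw σ Q).map Prod.fst).prod ((jointLaw σ Q).map Prod.snd))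

/-- Capacity `C(A, E)` of the channel `Y = X + Z`, `Z ~ N(0, σ²)`, with peak-power
constraint `A` (i.e. `P(0 ≤ X ≤ A) = 1`) and average-power constraint `E[X] ≤ E`:
the supremum of the mutual information over all admissible input laws. -/
noncomputable def capacity (σ A E : ℝ) : EReal :=
  ⨆ Q ∈ {Q : Measure ℝ | IsProbabilityMeasure Q ∧ Q (Set.Icc 0 A) = 1 ∧
      ∫⁻ x, ENNReal.ofReal x ∂Q ≤ ENNReal.ofReal E}, mutualInfo σ Q

noncomputable def gE (σ x y : ℝ) : ℝ := rexp ((x * y - x ^ 2 / 2) / σ ^ 2)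

noncomputable def rE (σ : ℝ) (Q : Measure ℝ) (y : ℝ) : ENNReal :=
  ∫⁻ x, ENNReal.ofReal (gE σ x y) ∂Q

noncomputable def vv (σ : ℝ) : NNReal := ⟨σ ^ 2, sq_nonneg σ⟩

lemma joint_def (σ : ℝ) (Q : Measure ℝ) : jointLaw σ Q =
    (Q.prod (gaussianReal 0 (vv σ))).map (fun p => (p.1, p.1 + p.2)) := rfl

lemma vv_coe (σ : ℝ) : ((vv σ : NNReal) : ℝ) = σ ^ 2 := rfl

lemma vv_ne {σ : ℝ} (hσ : 0 < σ) : vv σ ≠ 0 := by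
  intro h
  have h2 := congrArg NNReal.toReal h
  change σ ^ 2 = 0 at h2
  exact hσ.ne' (pow_eq_zero_iff two_ne_zero |>.1 h2)

lemma gE_pos (σ x y : ℝ) : 0 < gE σ x y := Real.exp_pos _

@[fun_prop]
lemma measurable_gE (σ : ℝ) : Measurable (fun p : ℝ × ℝ => gE σ p.1 p.2) := by
  unfold gE; fun_prop

lemma measurable_gE_right (σ x : ℝ) : Measurable (fun y => gE σ x y) := by
  unfold gE; fun_prop

lemma measurable_rE (σ : ℝ) (Q : Measure ℝ) [SFinite Q] : Measurable (rE σ Q) := by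
  unfold rE
  exact Measurable.lintegral_prod_left' (f := fun p : ℝ × ℝ => ENNReal.ofReal (gE σ p.1 p.2))
    (measurable_gE σ).ennreal_ofReal

lemma gaussian_shift {σ : ℝ} (hσ : 0 < σ) (x : ℝ) :
    gaussianReal x (vv σ) =
      (gaussianReal 0 (vv σ)).withDensity (fun y => ENNReal.ofReal (gE σ x y)) := by
  rw [gaussianReal_of_var_ne_zero _ (vv_ne hσ), gaussianReal_of_var_ne_zero _ (vv_ne hσ),
    ← withDensity_mul _ (measurable_gaussianPDF _ _) (measurable_gE_right σ x).ennreal_ofReal]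
  congr 1
  ext y
  simp only [Pi.mul_apply, gaussianPDF, gaussianPDFReal]
  rw [← ENNReal.ofReal_mul (by positivity)]
  congr 1
  rw [gE, mul_assoc _ (rexp _) (rexp _), ← Real.exp_add]
  congr 2
  simp only [vv_coe]
  field_simp
  ring

lemma joint_eq {σ : ℝ} (hσ : 0 < σ) (Q : Measure ℝ) [SFinite Q] :
    jointLaw σ Q = (Q.prod (gaussianReal 0 (vv σ))).withDensity
      (fun p => ENNReal.ofReal (gE σ p.1 p.2)) := by
  refine Measure.ext_of_lintegral _ fun F hF => ?_
  rw [joint_def]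
  rw [lintegral_map hF (by fun_prop), lintegral_prod _ (by fun_prop),
    lintegral_withDensity_eq_lintegral_mul _ (measurable_gE σ).ennreal_ofReal hF,
    lintegral_prod _ (by fun_prop)]
  refine lintegral_congr fun x => ?_
  have h := gaussianReal_map_const_add (μ := 0) (v := vv σ) x
  rw [zero_add, gaussian_shift hσ x] at h
  have h2 : ∫⁻ y, F (x, x + y) ∂(gaussianReal 0 (vv σ)) =
      ∫⁻ y, F (x, y) ∂((gaussianReal 0 (vv σ)).map (x + ·)) := by
    rw [lintegral_map (by fun_prop) (by fun_prop)]
  change ∫⁻ y, F (x, x + y) ∂(gaussianReal 0 (vv σ)) = _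
  rw [h2, h, lintegral_withDensity_eq_lintegral_mul _
    (measurable_gE_right σ x).ennreal_ofReal (by fun_prop)]
  rfl

lemma joint_fst (σ : ℝ) (Q : Measure ℝ) [IsProbabilityMeasure Q] :
    (jointLaw σ Q).map Prod.fst = Q := by
  rw [joint_def]
  rw [Measure.map_map (by fun_prop) (by fun_prop)]
  exact Measure.fst_prod

lemma joint_snd {σ : ℝ} (hσ : 0 < σ) (Q : Measure ℝ) [SFinite Q] :
    (jointLaw σ Q).map Prod.snd = (gaussianReal 0 (vv σ)).withDensity (rE σ Q) := by
  rw [joint_eq hσ]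
  refine Measure.ext_of_lintegral _ fun F hF => ?_
  rw [lintegral_map hF (by fun_prop),
    lintegral_withDensity_eq_lintegral_mul _ (measurable_gE σ).ennreal_ofReal (by fun_prop),
    lintegral_withDensity_eq_lintegral_mul _ (measurable_rE σ Q) (by fun_prop),
    lintegral_prod_symm _ (by fun_prop)]
  refine lintegral_congr fun y => ?_
  simp only [Pi.mul_apply, rE]
  rw [lintegral_mul_const]
  have := measurable_gE σ
  exact (this.comp (measurable_id.prodMk measurable_const)).ennreal_ofReal

lemma gE_bound {σ A x : ℝ} (hx : x ∈ Icc 0 A) (y : ℝ) :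
    |(x * y - x ^ 2 / 2) / σ ^ 2| ≤ (A * |y| + A ^ 2 / 2) / σ ^ 2 := by
  rw [abs_div, abs_of_nonneg (sq_nonneg σ)]
  gcongr
  obtain ⟨h0, h1⟩ := hx
  refine (abs_sub _ _).trans ?_
  rw [abs_mul, abs_of_nonneg h0, abs_of_nonneg (by positivity : 0 ≤ x ^ 2 / 2)]
  gcongr

lemma ae_Icc {A : ℝ} {Q : Measure ℝ} [IsProbabilityMeasure Q] (hQ : Q (Icc 0 A) = 1) :
    ∀ᵐ x ∂Q, x ∈ Icc 0 A :=
  (mem_ae_iff_prob_eq_one measurableSet_Icc).2 hQ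

lemma rE_le {σ A : ℝ} {Q : Measure ℝ} [IsProbabilityMeasure Q] (hQ : Q (Icc 0 A) = 1) (y : ℝ) :
    rE σ Q y ≤ ENNReal.ofReal (rexp ((A * |y| + A ^ 2 / 2) / σ ^ 2)) := by
  have : rE σ Q y ≤ ∫⁻ x, ENNReal.ofReal (rexp ((A * |y| + A ^ 2 / 2) / σ ^ 2)) ∂Q := by
    refine lintegral_mono_ae ?_
    filter_upwards [ae_Icc hQ] with x hx
    exact ENNReal.ofReal_le_ofReal (Real.exp_le_exp.2 (abs_le.1 (gE_bound hx y)).2)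
  simpa using this

lemma le_rE {σ A : ℝ} {Q : Measure ℝ} [IsProbabilityMeasure Q] (hQ : Q (Icc 0 A) = 1) (y : ℝ) :
    ENNReal.ofReal (rexp (-((A * |y| + A ^ 2 / 2) / σ ^ 2))) ≤ rE σ Q y := by
  have : ∫⁻ x, ENNReal.ofReal (rexp (-((A * |y| + A ^ 2 / 2) / σ ^ 2))) ∂Q ≤ rE σ Q y := by
    refine lintegral_mono_ae ?_
    filter_upwards [ae_Icc hQ] with x hx
    exact ENNReal.ofReal_le_ofReal (Real.exp_le_exp.2 (abs_le.1 (gE_bound hx y)).1)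
  simpa using this

lemma rE_ne_top {σ A : ℝ} {Q : Measure ℝ} [IsProbabilityMeasure Q] (hQ : Q (Icc 0 A) = 1)
    (y : ℝ) : rE σ Q y ≠ ⊤ := ((rE_le hQ y).trans_lt ENNReal.ofReal_lt_top).ne

lemma rE_ne_zero {σ A : ℝ} {Q : Measure ℝ} [IsProbabilityMeasure Q] (hQ : Q (Icc 0 A) = 1)
    (y : ℝ) : rE σ Q y ≠ 0 :=
  ((ENNReal.ofReal_pos.2 (Real.exp_pos _)).trans_le (le_rE (σ := σ) hQ y)).ne'

lemma rE_pos {σ A : ℝ} {Q : Measure ℝ} [IsProbabilityMeasure Q] (hQ : Q (Icc 0 A) = 1)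
    (y : ℝ) : 0 < (rE σ Q y).toReal := ENNReal.toReal_pos (rE_ne_zero hQ y) (rE_ne_top hQ y)

lemma log_rE_bound {σ A : ℝ} {Q : Measure ℝ} [IsProbabilityMeasure Q] (hQ : Q (Icc 0 A) = 1)
    (y : ℝ) : |Real.log (rE σ Q y).toReal| ≤ (A * |y| + A ^ 2 / 2) / σ ^ 2 := by
  rw [abs_le]
  constructor
  · rw [Real.le_log_iff_exp_le (rE_pos hQ y)]
    exact (ENNReal.ofReal_le_iff_le_toReal (rE_ne_top hQ y)).1 (le_rE hQ y)
  · rw [Real.log_le_iff_le_exp (rE_pos hQ y)]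
    exact ENNReal.toReal_le_of_le_ofReal (Real.exp_pos _).le (rE_le hQ y)

instance {σ : ℝ} {Q : Measure ℝ} [IsProbabilityMeasure Q] :
    IsProbabilityMeasure (jointLaw σ Q) := by
  rw [joint_def]
  exact Measure.isProbabilityMeasure_map (by fun_prop)

lemma int_fst {A : ℝ} {Q : Measure ℝ} [IsProbabilityMeasure Q] (hQ : Q (Icc 0 A) = 1) :
    Integrable (fun x : ℝ => x) Q :=
  Integrable.of_bound (by fun_prop) A (by
    filter_upwards [ae_Icc hQ] with x hx
    rw [Real.norm_eq_abs, abs_of_nonneg hx.1]; exact hx.2)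

lemma int_sq {A : ℝ} {Q : Measure ℝ} [IsProbabilityMeasure Q] (hQ : Q (Icc 0 A) = 1) :
    Integrable (fun x : ℝ => x ^ 2) Q :=
  Integrable.of_bound (by fun_prop) (A ^ 2) (by
    filter_upwards [ae_Icc hQ] with x hx
    rw [Real.norm_eq_abs, abs_of_nonneg (sq_nonneg x)]
    exact pow_le_pow_left₀ hx.1 hx.2 2)

lemma int_gauss (σ : ℝ) : Integrable (fun x : ℝ => x) (gaussianReal 0 (vv σ)) :=
  (memLp_id_gaussianReal 1).integrable (by simp)

lemma int_Y {σ A : ℝ} {Q : Measure ℝ} [IsProbabilityMeasure Q] (hQ : Q (Icc 0 A) = 1) :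
    Integrable (fun p : ℝ × ℝ => p.2) (jointLaw σ Q) := by
  rw [joint_def]
  rw [integrable_map_measure (by fun_prop) (by fun_prop)]
  exact ((int_fst hQ).comp_fst _).add ((int_gauss σ).comp_snd _)

lemma integral_Y {σ A : ℝ} {Q : Measure ℝ} [IsProbabilityMeasure Q] (hQ : Q (Icc 0 A) = 1) :
    ∫ p, p.2 ∂(jointLaw σ Q) = ∫ x, x ∂Q := by
  rw [joint_def]
  rw [integral_map (by fun_prop) (by fun_prop)]
  change ∫ p, p.1 + p.2 ∂(Q.prod (gaussianReal 0 (vv σ))) = _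
  rw [integral_add ((int_fst hQ).comp_fst _) ((int_gauss σ).comp_snd _),
    integral_fun_fst (fun x : ℝ => x), integral_fun_snd (fun x : ℝ => x), integral_id_gaussianReal]
  simp

lemma int_XY {σ A : ℝ} {Q : Measure ℝ} [IsProbabilityMeasure Q] (hQ : Q (Icc 0 A) = 1) :
    Integrable (fun p : ℝ × ℝ => (p.1 * p.2 - p.1 ^ 2 / 2) / σ ^ 2) (jointLaw σ Q) := by
  rw [joint_def]
  rw [integrable_map_measure (by fun_prop) (by fun_prop)]
  have h1 := (((int_sq hQ).comp_fst (gaussianReal 0 (vv σ))).div_const 2).add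
    ((int_fst hQ).mul_prod (int_gauss σ))
  refine (h1.div_const (σ ^ 2)).congr (ae_of_all _ fun p => ?_)
  simp only [Function.comp, Pi.add_apply]
  ring

lemma integral_XY {σ A : ℝ} {Q : Measure ℝ} [IsProbabilityMeasure Q] (hQ : Q (Icc 0 A) = 1) :
    ∫ p, (p.1 * p.2 - p.1 ^ 2 / 2) / σ ^ 2 ∂(jointLaw σ Q) = (∫ x, x ^ 2 ∂Q) / (2 * σ ^ 2) := by
  rw [joint_def]
  rw [integral_map (by fun_prop) (by fun_prop)]
  have h1 := (((int_sq hQ).comp_fst (gaussianReal 0 (vv σ))).div_const 2)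
  have h2 := ((int_fst hQ).mul_prod (int_gauss σ))
  have e : ∀ p : ℝ × ℝ, (p.1 * (p.1 + p.2) - p.1 ^ 2 / 2) / σ ^ 2 =
    (p.1 ^ 2 / 2 + p.1 * p.2) / σ ^ 2 := fun p => by ring
  simp only [e]
  rw [integral_div]
  change (∫ p, p.1 ^ 2 / 2 + p.1 * p.2 ∂(Q.prod (gaussianReal 0 (vv σ)))) / _ = _
  rw [integral_add h1 h2, integral_prod_mul (fun x : ℝ => x) (fun x : ℝ => x),
    integral_fun_fst (fun x : ℝ => x ^ 2 / 2), integral_id_gaussianReal, integral_div]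
  simp
  ring

lemma int_log {σ A : ℝ} {Q : Measure ℝ} [IsProbabilityMeasure Q] (hQ : Q (Icc 0 A) = 1) :
    Integrable (fun p : ℝ × ℝ => Real.log (rE σ Q p.2).toReal) (jointLaw σ Q) := by
  have hm := measurable_rE σ Q
  refine Integrable.mono' ((((int_Y hQ).abs.const_mul A).add
    (integrable_const (A ^ 2 / 2))).div_const (σ ^ 2))
    (Real.measurable_log.comp (hm.comp measurable_snd).ennreal_toReal).aestronglyMeasurable
    (ae_of_all _ fun p => log_rE_bound hQ _)

lemma mutualInfo_eq {σ A : ℝ} (hσ : 0 < σ) {Q : Measure ℝ} [IsProbabilityMeasure Q]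
    (hQ : Q (Icc 0 A) = 1) :
    mutualInfo σ Q = (((∫ x, x ^ 2 ∂Q) / (2 * σ ^ 2) -
      ∫ p, Real.log (rE σ Q p.2).toReal ∂(jointLaw σ Q) : ℝ) : EReal) := by
  have hm := measurable_rE σ Q
  have hg := measurable_gE σ
  have hprob : IsProbabilityMeasure ((jointLaw σ Q).map Prod.snd) :=
    Measure.isProbabilityMeasure_map (by fun_prop)
  set R := Q.prod ((jointLaw σ Q).map Prod.snd) with hR
  have hR2 : R = (Q.prod (gaussianReal 0 (vv σ))).withDensity (fun p => rE σ Q p.2) := by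
    rw [hR, joint_snd hσ, prod_withDensity_right hm]
  have hfm : Measurable (fun p : ℝ × ℝ => ENNReal.ofReal (gE σ p.1 p.2) / rE σ Q p.2) := by
    fun_prop
  have hJ : jointLaw σ Q = R.withDensity
      (fun p => ENNReal.ofReal (gE σ p.1 p.2) / rE σ Q p.2) := by
    rw [hR2, ← withDensity_mul _ (by fun_prop) hfm, joint_eq hσ]
    congr 1
    ext p
    exact (ENNReal.mul_div_cancel (rE_ne_zero hQ _) (rE_ne_top hQ _)).symm
  have hac : jointLaw σ Q ≪ R := by
    rw [hJ]; exact withDensity_absolutelyContinuous _ _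
  have hllr : llr (jointLaw σ Q) R =ᵐ[jointLaw σ Q] fun p =>
      (p.1 * p.2 - p.1 ^ 2 / 2) / σ ^ 2 - Real.log (rE σ Q p.2).toReal := by
    refine hac.ae_le ?_
    have := Measure.rnDeriv_withDensity R hfm
    rw [← hJ] at this
    filter_upwards [this] with p hp
    rw [llr, hp, ENNReal.toReal_div, ENNReal.toReal_ofReal (gE_pos _ _ _).le,
      Real.log_div (gE_pos _ _ _).ne' (rE_pos hQ _).ne', gE, Real.log_exp]
  have hi : Integrable (llr (jointLaw σ Q) R) (jointLaw σ Q) :=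
    ((int_XY hQ).sub (int_log hQ)).congr hllr.symm
  unfold mutualInfo klDiv
  rw [joint_fst, ← hR, if_pos ⟨hac, hi⟩, integral_congr_ae hllr,
    integral_sub (int_XY hQ) (int_log hQ), integral_XY hQ]

lemma integrable_snd {σ A : ℝ} (hσ : 0 < σ) {Q : Measure ℝ} [IsProbabilityMeasure Q]
    (hQ : Q (Icc 0 A) = 1) {F : ℝ → ℝ} (hF : Measurable F)
    (h : Integrable (fun y => (rE σ Q y).toReal * F y) (gaussianReal 0 (vv σ))) :
    Integrable (fun p : ℝ × ℝ => F p.2) (jointLaw σ Q) := by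
  have : Integrable F ((jointLaw σ Q).map Prod.snd) := by
    rw [joint_snd hσ, integrable_withDensity_iff_integrable_smul' (measurable_rE σ Q)
      (ae_of_all _ fun y => (rE_ne_top hQ y).lt_top)]
    exact h
  rwa [integrable_map_measure hF.aestronglyMeasurable (by fun_prop)] at this

lemma integral_snd {σ A : ℝ} (hσ : 0 < σ) {Q : Measure ℝ} [IsProbabilityMeasure Q]
    (hQ : Q (Icc 0 A) = 1) {F : ℝ → ℝ} (hF : Measurable F) :
    ∫ p, F p.2 ∂(jointLaw σ Q) = ∫ y, (rE σ Q y).toReal * F y ∂(gaussianReal 0 (vv σ)) := by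
  have : ∫ y, F y ∂((jointLaw σ Q).map Prod.snd) = ∫ p, F p.2 ∂(jointLaw σ Q) :=
    integral_map (by fun_prop) hF.aestronglyMeasurable
  rw [← this, joint_snd hσ, integral_withDensity_eq_integral_toReal_smul (measurable_rE σ Q)
      (ae_of_all _ fun y => (rE_ne_top hQ y).lt_top)]
  rfl

lemma integrable_exp_lin (σ c d : ℝ) :
    Integrable (fun y => rexp (c * y + d)) (gaussianReal 0 (vv σ)) := by
  simp only [Real.exp_add]
  exact (integrable_exp_mul_gaussianReal c).mul_const _

lemma integral_exp_lin (σ c d : ℝ) :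
    ∫ y, rexp (c * y + d) ∂(gaussianReal 0 (vv σ)) = rexp (σ ^ 2 * c ^ 2 / 2 + d) := by
  simp only [Real.exp_add]
  rw [integral_mul_const]
  have := congrFun (mgf_id_gaussianReal (μ := 0) (v := vv σ)) c
  simp only [mgf, id, vv_coe, zero_mul, zero_add] at this
  rw [this]

lemma integrable_ggg (σ a b m : ℝ) :
    Integrable (fun y => gE σ a y * gE σ b y / gE σ m y) (gaussianReal 0 (vv σ)) := by
  refine (integrable_exp_lin σ ((a + b - m) / σ ^ 2) (-((a ^ 2 + b ^ 2 - m ^ 2) / 2) / σ ^ 2)).congr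
    (ae_of_all _ fun y => ?_)
  simp only [gE]
  rw [← Real.exp_add, ← Real.exp_sub]
  congr 1
  ring

lemma integral_ggg {σ : ℝ} (hσ : 0 < σ) (a b m : ℝ) :
    ∫ y, gE σ a y * gE σ b y / gE σ m y ∂(gaussianReal 0 (vv σ)) =
      rexp ((a - m) * (b - m) / σ ^ 2) := by
  have := integral_exp_lin σ ((a + b - m) / σ ^ 2) (-((a ^ 2 + b ^ 2 - m ^ 2) / 2) / σ ^ 2)
  have h2 : σ ^ 2 * ((a + b - m) / σ ^ 2) ^ 2 / 2 + (-((a ^ 2 + b ^ 2 - m ^ 2) / 2) / σ ^ 2) =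
    (a - m) * (b - m) / σ ^ 2 := by
    field_simp
    ring
  rw [h2] at this
  rw [← this]
  refine integral_congr_ae (ae_of_all _ fun y => ?_)
  simp only [gE]
  rw [← Real.exp_add, ← Real.exp_sub]
  congr 1
  ring

lemma gE_zero (σ y : ℝ) : gE σ 0 y = 1 := by simp [gE]

lemma log_gE (σ x y : ℝ) : Real.log (gE σ x y) = (x * y - x ^ 2 / 2) / σ ^ 2 := by
  rw [gE, Real.log_exp]

lemma int_lin {σ A : ℝ} {Q : Measure ℝ} [IsProbabilityMeasure Q] (hQ : Q (Icc 0 A) = 1) (m : ℝ) :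
    Integrable (fun p : ℝ × ℝ => Real.log (gE σ m p.2)) (jointLaw σ Q) := by
  simp only [log_gE]
  exact (((int_Y hQ).const_mul m).sub (integrable_const _)).div_const _

lemma integral_lin {σ A : ℝ} {Q : Measure ℝ} [IsProbabilityMeasure Q]
    (hQ : Q (Icc 0 A) = 1) :
    ∫ p, Real.log (gE σ (∫ x, x ∂Q) p.2) ∂(jointLaw σ Q) = (∫ x, x ∂Q) ^ 2 / (2 * σ ^ 2) := by
  simp only [log_gE]
  rw [integral_div, integral_sub ((int_Y hQ).const_mul _) (integrable_const _),
    integral_const_mul, integral_Y hQ]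
  simp
  ring

lemma log_ge {σ A : ℝ} (hσ : 0 < σ) {Q : Measure ℝ} [IsProbabilityMeasure Q]
    (hQ : Q (Icc 0 A) = 1) :
    (∫ x, x ∂Q) ^ 2 / (2 * σ ^ 2) ≤ ∫ p, Real.log (rE σ Q p.2).toReal ∂(jointLaw σ Q) := by
  set m := ∫ x, x ∂Q with hm
  have hmr := measurable_rE σ Q
  have hmg := measurable_gE_right σ m
  have hF : Measurable (fun y => gE σ m y / (rE σ Q y).toReal) := by fun_prop
  have e : ∀ y, (rE σ Q y).toReal * (gE σ m y / (rE σ Q y).toReal) =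
      gE σ m y * gE σ 0 y / gE σ 0 y := fun y => by
    rw [gE_zero]; field_simp [(rE_pos (σ := σ) hQ y).ne']
  have hI := integrable_snd hσ hQ hF (by simp only [e]; exact integrable_ggg σ m 0 0)
  have hv := integral_snd hσ hQ hF
  simp only [e] at hv
  rw [integral_ggg hσ] at hv
  simp only [sub_zero, mul_zero, zero_div, Real.exp_zero] at hv
  have key : ∫ p, (Real.log (gE σ m p.2) + (1 - gE σ m p.2 / (rE σ Q p.2).toReal))
      ∂(jointLaw σ Q) = m ^ 2 / (2 * σ ^ 2) := by
    have hI2 : Integrable (fun p : ℝ × ℝ => 1 - gE σ m p.2 / (rE σ Q p.2).toReal)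
      (jointLaw σ Q) := (integrable_const _).sub hI
    rw [integral_add (int_lin hQ m) hI2,
      integral_sub (integrable_const _) hI, hv, hm, integral_lin hQ]
    simp
  rw [← key]
  refine integral_mono ((int_lin hQ m).add ((integrable_const _).sub hI)) (int_log hQ) fun p => ?_
  have hr := rE_pos (σ := σ) hQ p.2
  have hg := gE_pos σ m p.2
  have := Real.log_le_sub_one_of_pos (div_pos hg hr)
  rw [Real.log_div hg.ne' hr.ne'] at this
  simp only
  linarith

lemma log_le {σ A : ℝ} (hσ : 0 < σ) {Q : Measure ℝ} [IsProbabilityMeasure Q]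
    (hQ : Q (Icc 0 A) = 1) {K : ℝ}
    (hi : Integrable (fun y => (rE σ Q y).toReal * ((rE σ Q y).toReal / gE σ (∫ x, x ∂Q) y))
      (gaussianReal 0 (vv σ)))
    (hK : ∫ y, (rE σ Q y).toReal * ((rE σ Q y).toReal / gE σ (∫ x, x ∂Q) y)
      ∂(gaussianReal 0 (vv σ)) = K) :
    ∫ p, Real.log (rE σ Q p.2).toReal ∂(jointLaw σ Q) ≤
      (∫ x, x ∂Q) ^ 2 / (2 * σ ^ 2) + (K - 1) := by
  set m := ∫ x, x ∂Q with hm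
  have hmr := measurable_rE σ Q
  have hmg := measurable_gE_right σ m
  have hF : Measurable (fun y => (rE σ Q y).toReal / gE σ m y) := by fun_prop
  have hI := integrable_snd hσ hQ hF hi
  have hv := integral_snd hσ hQ hF
  rw [hK] at hv
  have key : ∫ p, (Real.log (gE σ m p.2) + ((rE σ Q p.2).toReal / gE σ m p.2 - 1))
      ∂(jointLaw σ Q) = m ^ 2 / (2 * σ ^ 2) + (K - 1) := by
    have hI2 : Integrable (fun p : ℝ × ℝ => (rE σ Q p.2).toReal / gE σ m p.2 - 1)
      (jointLaw σ Q) := hI.sub (integrable_const _)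
    rw [integral_add (int_lin hQ m) hI2,
      integral_sub hI (integrable_const _), hv, hm, integral_lin hQ]
    simp
  rw [← key]
  refine integral_mono (int_log hQ) ((int_lin hQ m).add (hI.sub (integrable_const _))) fun p => ?_
  have hr := rE_pos (σ := σ) hQ p.2
  have hg := gE_pos σ m p.2
  have := Real.log_le_sub_one_of_pos (div_pos hr hg)
  rw [Real.log_div hr.ne' hg.ne'] at this
  simp only
  linarith

lemma capacity_le {σ α A : ℝ} (hσ : 0 < σ) (hα₀ : 0 < α) (hα : α < 1 / 2) (hA : 0 < A) :
    capacity σ A (α * A) ≤ ((α * (1 - α) / 2 * (A ^ 2 / σ ^ 2) : ℝ) : EReal) := by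
  refine iSup₂_le fun Q hQ' => ?_
  obtain ⟨hp, hQ, hE⟩ := hQ'
  rw [mutualInfo_eq hσ hQ, EReal.coe_le_coe_iff]
  have h1 := log_ge hσ hQ
  have hm : ∫ x, x ∂Q ≤ α * A := by
    rw [integral_eq_lintegral_of_nonneg_ae
      (by filter_upwards [ae_Icc hQ] with x hx using hx.1) (by fun_prop)]
    exact ENNReal.toReal_le_of_le_ofReal (by positivity) hE
  have h2 : ∫ x, x ^ 2 ∂Q ≤ A * ∫ x, x ∂Q := by
    rw [← integral_const_mul]
    refine integral_mono_ae (int_sq hQ) ((int_fst hQ).const_mul A) ?_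
    filter_upwards [ae_Icc hQ] with x hx
    nlinarith [hx.1, hx.2]
  set m := ∫ x, x ∂Q
  have h3 : (∫ x, x ^ 2 ∂Q) - m ^ 2 ≤ α * (1 - α) * A ^ 2 := by
    nlinarith [mul_nonneg (sub_nonneg.2 hm) (by nlinarith : 0 ≤ A - α * A - m)]
  have h4 : ((∫ x, x ^ 2 ∂Q) - m ^ 2) / (2 * σ ^ 2) ≤ (α * (1 - α) * A ^ 2) / (2 * σ ^ 2) := by
    gcongr
  have h5 : (α * (1 - α) * A ^ 2) / (2 * σ ^ 2) = α * (1 - α) / 2 * (A ^ 2 / σ ^ 2) := by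
    field_simp
  rw [sub_div] at h4
  linarith

noncomputable def chi (α s : ℝ) : ℝ :=
  (1 - α) ^ 2 * rexp (α ^ 2 * s) + 2 * α * (1 - α) * rexp (-(α * (1 - α)) * s) +
    α ^ 2 * rexp ((1 - α) ^ 2 * s)

noncomputable def Q0 (α A : ℝ) : Measure ℝ :=
  ENNReal.ofReal (1 - α) • Measure.dirac 0 + ENNReal.ofReal α • Measure.dirac A

lemma Q0_prob {α : ℝ} (A : ℝ) (hα₀ : 0 < α) (hα : α < 1 / 2) : IsProbabilityMeasure (Q0 α A) := by
  constructor
  simp only [Q0, Measure.add_apply, Measure.smul_apply, measure_univ, smul_eq_mul, mul_one]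
  rw [← ENNReal.ofReal_add (by linarith) hα₀.le]
  simp

lemma Q0_lint {α : ℝ} (A : ℝ) (F : ℝ → ENNReal) :
    ∫⁻ x, F x ∂(Q0 α A) = ENNReal.ofReal (1 - α) * F 0 + ENNReal.ofReal α * F A := by
  rw [Q0, lintegral_add_measure, lintegral_smul_measure, lintegral_smul_measure,
    lintegral_dirac, lintegral_dirac]
  rfl

lemma Q0_int {α : ℝ} (A : ℝ) (hα₀ : 0 < α) (hα : α < 1 / 2) (F : ℝ → ℝ) :
    ∫ x, F x ∂(Q0 α A) = (1 - α) * F 0 + α * F A := by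
  have h : ∀ c a : ℝ, Integrable F (ENNReal.ofReal c • Measure.dirac a) := fun c a =>
    (integrable_dirac (by simp)).smul_measure (by simp)
  rw [Q0, integral_add_measure (h _ _) (h _ _), integral_smul_measure, integral_smul_measure,
    integral_dirac, integral_dirac, ENNReal.toReal_ofReal (by linarith),
    ENNReal.toReal_ofReal hα₀.le]
  rfl

lemma le_capacity {σ α A : ℝ} (hσ : 0 < σ) (hα₀ : 0 < α) (hα : α < 1 / 2) (hA : 0 < A) :
    ((α * (1 - α) / 2 * (A ^ 2 / σ ^ 2) - (chi α (A ^ 2 / σ ^ 2) - 1) : ℝ) : EReal) ≤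
      capacity σ A (α * A) := by
  have hp := Q0_prob A hα₀ hα
  have h1α : 0 ≤ 1 - α := by linarith
  have hQ : Q0 α A (Icc 0 A) = 1 := by
    have h0 : (0 : ℝ) ∈ Icc 0 A := ⟨le_rfl, hA.le⟩
    have h1 : A ∈ Icc 0 A := ⟨hA.le, le_rfl⟩
    simp only [Q0, Measure.add_apply, Measure.smul_apply, smul_eq_mul,
      Measure.dirac_apply_of_mem h0, Measure.dirac_apply_of_mem h1, mul_one]
    rw [← ENNReal.ofReal_add (by linarith) hα₀.le]
    simp
  have hE : ∫⁻ x, ENNReal.ofReal x ∂(Q0 α A) ≤ ENNReal.ofReal (α * A) := by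
    rw [Q0_lint, ENNReal.ofReal_mul hα₀.le]
    simp
  refine le_trans ?_ (le_iSup₂_of_le (Q0 α A) ⟨hp, hQ, hE⟩ le_rfl)
  rw [mutualInfo_eq hσ hQ, EReal.coe_le_coe_iff]
  have hm : ∫ x, x ∂(Q0 α A) = α * A := by
    rw [Q0_int A hα₀ hα (fun x => x)]; simp
  have hr : ∀ y, (rE σ (Q0 α A) y).toReal = (1 - α) * gE σ 0 y + α * gE σ A y := by
    intro y
    have hg := gE_pos σ A y
    have hg0 := gE_pos σ 0 y
    rw [rE, Q0_lint, ← ENNReal.ofReal_mul h1α, ← ENNReal.ofReal_mul hα₀.le,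
      ← ENNReal.ofReal_add (by positivity) (by positivity), ENNReal.toReal_ofReal (by positivity)]
  have e : ∀ y, (rE σ (Q0 α A) y).toReal * ((rE σ (Q0 α A) y).toReal /
      gE σ (∫ x, x ∂(Q0 α A)) y) = (1 - α) ^ 2 * (gE σ 0 y * gE σ 0 y / gE σ (α * A) y) +
        2 * α * (1 - α) * (gE σ 0 y * gE σ A y / gE σ (α * A) y) +
        α ^ 2 * (gE σ A y * gE σ A y / gE σ (α * A) y) := fun y => by
    rw [hr, hm]; ring
  have i1 := (integrable_ggg σ 0 0 (α * A)).const_mul ((1 - α) ^ 2)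
  have i2 := (integrable_ggg σ 0 A (α * A)).const_mul (2 * α * (1 - α))
  have i3 := (integrable_ggg σ A A (α * A)).const_mul (α ^ 2)
  have := log_le hσ hQ (K := chi α (A ^ 2 / σ ^ 2)) (by simp only [e]; exact (i1.add i2).add i3) (by
    simp only [e]
    have i12 : Integrable (fun y => (1 - α) ^ 2 * (gE σ 0 y * gE σ 0 y / gE σ (α * A) y) +
        2 * α * (1 - α) * (gE σ 0 y * gE σ A y / gE σ (α * A) y)) (gaussianReal 0 (vv σ)) :=
      i1.add i2
    rw [integral_add i12 i3, integral_add i1 i2, integral_const_mul, integral_const_mul,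
      integral_const_mul, integral_ggg hσ, integral_ggg hσ, integral_ggg hσ, chi]
    congr 3 <;> congr 1 <;> congr 1 <;> ring)
  rw [hm] at this
  rw [Q0_int A hα₀ hα (fun x => x ^ 2)]
  have e2 : ((1 - α) * 0 ^ 2 + α * A ^ 2) / (2 * σ ^ 2) =
     α * (1 - α) / 2 * (A ^ 2 / σ ^ 2) + (α * A) ^ 2 / (2 * σ ^ 2) := by
    field_simp; ring
  linarith

lemma chi_deriv (α : ℝ) : HasDerivAt (chi α) 0 0 := by
  have h : ∀ c d : ℝ, HasDerivAt (fun s => d * rexp (c * s)) (d * c) 0 := fun c d => by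
    have := (((hasDerivAt_id (0 : ℝ)).const_mul c).exp).const_mul d
    simpa using this
  have := ((h (α ^ 2) ((1 - α) ^ 2)).add (h (-(α * (1 - α))) (2 * α * (1 - α)))).add
    (h ((1 - α) ^ 2) (α ^ 2))
  have e : (1 - α) ^ 2 * α ^ 2 + 2 * α * (1 - α) * -(α * (1 - α)) + α ^ 2 * (1 - α) ^ 2 = 0 := by
    ring
  rw [e] at this
  exact this

lemma chi_lim (α : ℝ) : Tendsto (fun s => (chi α s - 1) / s) (𝓝[>] 0) (𝓝 0) := by
  have h := (hasDerivAt_iff_tendsto_slope.1 (chi_deriv α)).mono_left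
    (nhdsWithin_mono 0 (fun x hx => ne_of_gt hx) : 𝓝[>] (0:ℝ) ≤ 𝓝[≠] 0)
  refine h.congr fun s => ?_
  have h0 : chi α 0 = 1 := by simp [chi]; ring
  rw [slope_def_field, h0, sub_zero]

/-- Low-power asymptotics of `C(A, αA)` for `0 < α < 1/2`:
`C(A, αA)/(A²/σ²) → α(1−α)/2` as `A → 0⁺`. -/
theorem capacity_low_power_asymptotics_strong (σ α : ℝ) (hσ : 0 < σ)
    (hα₀ : 0 < α) (hα : α < 1 / 2) :
    Tendsto (fun A : ℝ => capacity σ A (α * A) / ((A ^ 2 / σ ^ 2 : ℝ) : EReal))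
      (𝓝[>] 0) (𝓝 ((α * (1 - α) / 2 : ℝ) : EReal)) := by
  have hs : Tendsto (fun A : ℝ => A ^ 2 / σ ^ 2) (𝓝[>] 0) (𝓝[>] 0) := by
    refine tendsto_nhdsWithin_iff.2 ⟨?_, ?_⟩
    · have : Tendsto (fun A : ℝ => A ^ 2 / σ ^ 2) (𝓝 0) (𝓝 (0 ^ 2 / σ ^ 2)) :=
        (Continuous.tendsto (by fun_prop) 0)
      simp only [ne_eq, OfNat.ofNat_ne_zero, not_false_eq_true, zero_pow, zero_div] at this
      exact this.mono_left nhdsWithin_le_nhds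
    · filter_upwards [self_mem_nhdsWithin] with A hA
      have : 0 < A := hA
      exact (by positivity : 0 < A ^ 2 / σ ^ 2)
  have hlow : Tendsto (fun A : ℝ => ((α * (1 - α) / 2 -
      (chi α (A ^ 2 / σ ^ 2) - 1) / (A ^ 2 / σ ^ 2) : ℝ) : EReal))
      (𝓝[>] 0) (𝓝 ((α * (1 - α) / 2 : ℝ) : EReal)) := by
    rw [EReal.tendsto_coe]
    have := ((chi_lim α).comp hs).const_sub (α * (1 - α) / 2)
    simpa using this
  refine tendsto_of_tendsto_of_tendsto_of_le_of_le' hlow tendsto_const_nhds ?_ ?_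
  · filter_upwards [self_mem_nhdsWithin] with A hA
    have hA' : 0 < A := hA
    have hpos : 0 < A ^ 2 / σ ^ 2 := by positivity
    rw [EReal.le_div_iff_mul_le (by exact_mod_cast hpos) (EReal.coe_ne_top _), ← EReal.coe_mul]
    convert le_capacity hσ hα₀ hα hA' using 2
    field_simp
  · filter_upwards [self_mem_nhdsWithin] with A hA
    have hA' : 0 < A := hA
    have hpos : 0 < A ^ 2 / σ ^ 2 := by positivity
    rw [EReal.div_le_iff_le_mul (by exact_mod_cast hpos) (EReal.coe_ne_top _), ← EReal.coe_mul,
      mul_comm (A ^ 2 / σ ^ 2)]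
    exact capacity_le hσ hα₀ hα hA'
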